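/- arXiv:1706.06348 — 8 statements merged into one kernel-verified Lean document; each statement's English description precedes it below -/
import Mathlib

section
/- Let D ⊆ ℝ^d be a nonempty convex compact set, f : ℝ^d → ℝ differentiable on a neighborhood of D with generalized curvature constant C̄_f, and let C > 0 satisfy C ≥ C̄_f. Fix x ∈ D, let s ∈ D be a minimizer of ⟨∇f(x), ·⟩ over D, let g := ⟨∇f(x), x − s⟩ be the Frank-Wolfe gap at x, set γ := min{1, g/C}, and y := x + γ(s − x). Then f(y) ≤ f(x) − g²/(2C) if g ≤ C, and f(y) ≤ f(x) − (g − C/2) if g > C. -/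
open scoped RealInnerProductSpace

/-- One-step descent guarantee for Frank-Wolfe. With `C > 0` an upper bound on
the generalized curvature constant `C̄_f` over the nonempty convex compact set `D`, if `x ∈ D`,
`s` minimizes `⟪∇f(x), ·⟫` over `D`, `g = ⟪∇f(x), x - s⟫` is the FW gap, `γ = min {1, g/C}`
and `y = x + γ(s - x)`, then `f(y) ≤ f(x) - g²/(2C)` when `g ≤ C`, and
`f(y) ≤ f(x) - (g - C/2)` when `g > C`. -/
theorem stmt2 {d : ℕ} (D : Set (EuclideanSpace ℝ (Fin d)))
    (hne : D.Nonempty) (hconv : Convex ℝ D) (hcomp : IsCompact D)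
    (f : EuclideanSpace ℝ (Fin d) → ℝ)
    (U : Set (EuclideanSpace ℝ (Fin d))) (hU : IsOpen U) (hDU : D ⊆ U)
    (hf : DifferentiableOn ℝ f U)
    (C : ℝ) (hCpos : 0 < C)
    (hC : ∀ x ∈ D, ∀ s ∈ D, ∀ γ ∈ Set.Ioc (0 : ℝ) 1,
      2 / γ ^ 2 * |f (x + γ • (s - x)) - f x - ⟪gradient f x, γ • (s - x)⟫| ≤ C)
    (x : EuclideanSpace ℝ (Fin d)) (hx : x ∈ D)
    (s : EuclideanSpace ℝ (Fin d)) (hs : s ∈ D)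
    (hmin : ∀ z ∈ D, ⟪gradient f x, s⟫ ≤ ⟪gradient f x, z⟫)
    (g γ : ℝ) (hgdef : g = ⟪gradient f x, x - s⟫) (hγ : γ = min 1 (g / C))
    (y : EuclideanSpace ℝ (Fin d)) (hy : y = x + γ • (s - x)) :
    (g ≤ C → f y ≤ f x - g ^ 2 / (2 * C)) ∧ (C < g → f y ≤ f x - (g - C / 2)) := by
  have hg : 0 ≤ g := by
    rw [hgdef, inner_sub_right]
    exact sub_nonneg.2 (hmin x hx)
  have descent : ∀ t ∈ Set.Ioc (0 : ℝ) 1,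
      f (x + t • (s - x)) ≤ f x - t * g + t ^ 2 / 2 * C := by
    intro t ht
    have ht0 : 0 < t := ht.1
    have hinner : ⟪gradient f x, t • (s - x)⟫ = -(t * g) := by
      rw [real_inner_smul_right, hgdef, ← neg_sub x s, inner_neg_right, mul_neg]
    have hbound := hC x hx s hs t ht
    rw [hinner] at hbound
    have habs : |f (x + t • (s - x)) - f x - -(t * g)| ≤ t ^ 2 / 2 * C := by
      calc _ = t ^ 2 / 2 * (2 / t ^ 2 * |f (x + t • (s - x)) - f x - -(t * g)|) := by
            field_simp
        _ ≤ t ^ 2 / 2 * C := by gcongr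
    linarith [le_abs_self (f (x + t • (s - x)) - f x - -(t * g))]
  subst hy
  constructor
  · intro hgC
    rw [min_eq_right ((div_le_one hCpos).2 hgC)] at hγ
    subst hγ
    rcases hg.eq_or_lt with h0 | hpos
    · simp [← h0]
    · refine (descent _ ⟨div_pos hpos hCpos, (div_le_one hCpos).2 hgC⟩).trans_eq ?_
      field_simp
      ring
  · intro hCg
    rw [min_eq_left ((one_le_div hCpos).2 hCg.le)] at hγ
    subst hγ
    linarith [descent 1 ⟨one_pos, le_rfl⟩]
end

section
/- Let P ∈ ℝ^{n×n} be a symmetric positive semidefinite matrix with nonnegative entries, let c := ‖P‖₂, and let D := {W ∈ ℝ^{n×k} : W ≥ 0 entrywise and W𝟙_k = 𝟙_n}. Then f(W) = (1/4)‖P − WWᵀ‖_F² is (3n + c)-smooth on D: for all W, Z ∈ D, ‖(WWᵀ − P)W − (ZZᵀ − P)Z‖_F ≤ (3n + c)‖W − Z‖_F, where (WWᵀ − P)W is the gradient of f at W. -/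
open Matrix

/-- The spectral norm (ℓ²-operator norm, largest singular value) of a real matrix. -/
noncomputable def specNorm {m n : ℕ} (A : Matrix (Fin m) (Fin n) ℝ) : ℝ :=
  ‖LinearMap.toContinuousLinearMap (Matrix.toEuclideanLin A)‖

/-- The Frobenius norm of a real matrix. -/
noncomputable def frobNorm {m n : ℕ} (A : Matrix (Fin m) (Fin n) ℝ) : ℝ :=
  Real.sqrt (∑ i, ∑ j, (A i j) ^ 2)

section FrobeniusNorm

attribute [local instance] Matrix.frobeniusNormedAddCommGroup

variable {l m n : ℕ}

lemma frobNorm_eq_norm (A : Matrix (Fin m) (Fin n) ℝ) : frobNorm A = ‖A‖ := by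
  simp [frobNorm, Matrix.frobenius_norm_def, Real.sqrt_eq_rpow]

lemma frobNorm_mul_le (A : Matrix (Fin l) (Fin m) ℝ) (B : Matrix (Fin m) (Fin n) ℝ) :
    frobNorm (A * B) ≤ frobNorm A * frobNorm B := by
  simpa only [frobNorm_eq_norm] using Matrix.frobenius_norm_mul A B

lemma frobNorm_transpose (A : Matrix (Fin m) (Fin n) ℝ) : frobNorm Aᵀ = frobNorm A := by
  simpa only [frobNorm_eq_norm] using Matrix.frobenius_norm_transpose A

lemma frobNorm_add_le (A B : Matrix (Fin m) (Fin n) ℝ) :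
    frobNorm (A + B) ≤ frobNorm A + frobNorm B := by
  simpa only [frobNorm_eq_norm] using norm_add_le A B

lemma frobNorm_sub_le (A B : Matrix (Fin m) (Fin n) ℝ) :
    frobNorm (A - B) ≤ frobNorm A + frobNorm B := by
  simpa only [frobNorm_eq_norm] using norm_sub_le A B

lemma frobNorm_nonneg (A : Matrix (Fin m) (Fin n) ℝ) : 0 ≤ frobNorm A :=
  Real.sqrt_nonneg _

end FrobeniusNorm

lemma specNorm_nonneg {m n : ℕ} (A : Matrix (Fin m) (Fin n) ℝ) : 0 ≤ specNorm A :=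
  norm_nonneg _

lemma sum_sq_mulVec_le {m n : ℕ} (A : Matrix (Fin m) (Fin n) ℝ) (v : Fin n → ℝ) :
    ∑ i, (A *ᵥ v) i ^ 2 ≤ specNorm A ^ 2 * ∑ j, v j ^ 2 := by
  have h := (LinearMap.toContinuousLinearMap (Matrix.toEuclideanLin A)).le_opNorm
    (WithLp.toLp 2 v)
  have h_sq := pow_le_pow_left₀ (norm_nonneg _) h 2
  rw [mul_pow, EuclideanSpace.norm_sq_eq, EuclideanSpace.norm_sq_eq] at h_sq
  simpa [specNorm] using h_sq

lemma frobNorm_mul_le_specNorm_mul {l m n : ℕ} (A : Matrix (Fin l) (Fin m) ℝ)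
    (B : Matrix (Fin m) (Fin n) ℝ) : frobNorm (A * B) ≤ specNorm A * frobNorm B := by
  refine Real.sqrt_le_iff.2 ⟨mul_nonneg (specNorm_nonneg A) (frobNorm_nonneg B), ?_⟩
  rw [mul_pow, frobNorm, Real.sq_sqrt (by positivity), Finset.sum_comm,
    Finset.sum_comm (f := fun i j => B i j ^ 2), Finset.mul_sum]
  exact Finset.sum_le_sum fun j _ => sum_sq_mulVec_le A fun i => B i j

lemma frobNorm_le_sqrt_of_rowStochastic {n k : ℕ} {W : Matrix (Fin n) (Fin k) ℝ}
    (hW : ∀ i j, 0 ≤ W i j) (hW_sum : ∀ i, ∑ j, W i j = 1) : frobNorm W ≤ √n := by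
  refine Real.sqrt_le_sqrt ?_
  have h_row (i : Fin n) : ∑ j, W i j ^ 2 ≤ 1 := by
    simpa [hW_sum i] using
      Finset.sum_sq_le_sq_sum_of_nonneg (s := Finset.univ) fun j _ => hW i j
  simpa using Finset.sum_le_sum fun i (_ : i ∈ Finset.univ) => h_row i

/-- For symmetric PSD `P ≥ 0` with `c = ‖P‖₂`, the function
`f(W) = (1/4)‖P - WWᵀ‖_F²` is `(3n + c)`-smooth on the set of row-stochastic matrices:
its gradient `∇f(W) = (WWᵀ - P)W` is `(3n + c)`-Lipschitz in the Frobenius norm. -/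
theorem stmt7 (n k : ℕ) (P : Matrix (Fin n) (Fin n) ℝ)
    (hPsymm : P.IsSymm) (hPpsd : P.PosSemidef) (hPnonneg : ∀ i j, 0 ≤ P i j)
    (c : ℝ) (hc : c = specNorm P) :
    ∀ W Z : Matrix (Fin n) (Fin k) ℝ,
      (∀ i j, 0 ≤ W i j) → (∀ i, ∑ j, W i j = 1) →
      (∀ i j, 0 ≤ Z i j) → (∀ i, ∑ j, Z i j = 1) →
      frobNorm ((W * Wᵀ - P) * W - (Z * Zᵀ - P) * Z) ≤ (3 * n + c) * frobNorm (W - Z) := by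
  intro W Z hW hW_sum hZ hZ_sum
  have hW_norm := frobNorm_le_sqrt_of_rowStochastic hW hW_sum
  have hZ_norm := frobNorm_le_sqrt_of_rowStochastic hZ hZ_sum
  have hD := frobNorm_nonneg (W - Z)
  have hn : √(n : ℝ) * √n = n := Real.mul_self_sqrt n.cast_nonneg
  have h_triple {a b d e : ℕ} (A : Matrix (Fin a) (Fin b) ℝ) (B : Matrix (Fin b) (Fin d) ℝ)
      (C : Matrix (Fin d) (Fin e) ℝ) :
      frobNorm (A * B * C) ≤ frobNorm A * frobNorm B * frobNorm C :=
    (frobNorm_mul_le _ _).trans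
      (mul_le_mul_of_nonneg_right (frobNorm_mul_le _ _) (frobNorm_nonneg C))
  have h_split : (W * Wᵀ - P) * W - (Z * Zᵀ - P) * Z =
      W * Wᵀ * (W - Z) + W * (W - Z)ᵀ * Z + (W - Z) * Zᵀ * Z - P * (W - Z) := by
    simp only [Matrix.transpose_sub, Matrix.mul_sub, Matrix.sub_mul]
    abel
  have h₁ : frobNorm (W * Wᵀ * (W - Z)) ≤ n * frobNorm (W - Z) := by
    refine (h_triple _ _ _).trans ?_
    rw [frobNorm_transpose, ← hn]
    gcongr
    exact frobNorm_nonneg W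
  have h₂ : frobNorm (W * (W - Z)ᵀ * Z) ≤ n * frobNorm (W - Z) := by
    refine (h_triple _ _ _).trans ?_
    rw [frobNorm_transpose, ← hn, mul_right_comm]
    gcongr
    exact frobNorm_nonneg Z
  have h₃ : frobNorm ((W - Z) * Zᵀ * Z) ≤ n * frobNorm (W - Z) := by
    refine (h_triple _ _ _).trans ?_
    rw [frobNorm_transpose, ← hn, mul_assoc, mul_comm]
    gcongr
    exact frobNorm_nonneg Z
  rw [h_split, hc]
  linarith [frobNorm_sub_le (W * Wᵀ * (W - Z) + W * (W - Z)ᵀ * Z + (W - Z) * Zᵀ * Z) (P * (W - Z)),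
    frobNorm_add_le (W * Wᵀ * (W - Z) + W * (W - Z)ᵀ * Z) ((W - Z) * Zᵀ * Z),
    frobNorm_add_le (W * Wᵀ * (W - Z)) (W * (W - Z)ᵀ * Z),
    frobNorm_mul_le_specNorm_mul P (W - Z)]
end

section
/- Let P ∈ ℝ^{n×n} be a symmetric positive semidefinite matrix with nonnegative entries, c := ‖P‖₂, and D := {W ∈ ℝ^{n×k} : W ≥ 0 entrywise and W𝟙_k = 𝟙_n} with n ≥ 1 and k ≥ 1. Let f(W) = (1/4)‖P − WWᵀ‖_F², whose second derivative at W is the symmetric bilinear form D²f(W)[U, V] = ⟨U WᵀW + W UᵀW + (WWᵀ − P)U, V⟩_F. Then for every W ∈ D, the operator norm of this Hessian form satisfies sup_{U ∈ ℝ^{n×k}, ‖U‖_F ≤ 1} |⟨U WᵀW + W UᵀW + (WWᵀ − P)U, U⟩_F| ≥ n/k² − c. -/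
open Matrix

/-- A diagonal entry is bounded by the spectral norm. -/
lemma diag_le_specNorm {n : ℕ} (P : Matrix (Fin n) (Fin n) ℝ) (i : Fin n) :
    P i i ≤ specNorm P := by
  have hop := (LinearMap.toContinuousLinearMap (Matrix.toEuclideanLin P)).le_opNorm
    (EuclideanSpace.single i (1 : ℝ))
  have hcoord := PiLp.norm_apply_le
    (Matrix.toEuclideanLin P (EuclideanSpace.single i (1 : ℝ))) i
  have hentry : (Matrix.toEuclideanLin P (EuclideanSpace.single i (1 : ℝ))) i = P i i := by
    simp [Matrix.toLpLin_apply]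
  rw [hentry, Real.norm_eq_abs] at hcoord
  simp only [LinearMap.coe_toContinuousLinearMap', PiLp.norm_single, norm_one,
    mul_one] at hop
  exact (le_abs_self _).trans (hcoord.trans hop)

/-- Some column of a matrix with unit row sums has squared norm at least `n / k ^ 2`. -/
lemma exists_div_sq_le_sum_sq_col {n k : ℕ} (hk : 1 ≤ k) (W : Matrix (Fin n) (Fin k) ℝ)
    (hW : ∀ i, ∑ j, W i j = 1) : ∃ j, (n / k ^ 2 : ℝ) ≤ ∑ i, W i j ^ 2 := by
  have : NeZero k := ⟨by omega⟩
  have hk0 : (0 : ℝ) < k := by exact_mod_cast hk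
  have hrow (i : Fin n) : (1 / k : ℝ) ≤ ∑ j, W i j ^ 2 := by
    have h := sq_sum_le_card_mul_sum_sq (s := Finset.univ) (f := W i)
    rw [hW, Finset.card_univ, Fintype.card_fin, one_pow] at h
    rwa [div_le_iff₀' hk0]
  obtain ⟨j, -, hj⟩ := Finset.exists_le_of_sum_le (s := (Finset.univ : Finset (Fin k)))
    (f := fun _ => (n / k ^ 2 : ℝ)) (g := fun j => ∑ i, W i j ^ 2) Finset.univ_nonempty (by
      rw [Finset.sum_comm]
      calc ∑ _j : Fin k, (n / k ^ 2 : ℝ) = ∑ _i : Fin n, (1 / k : ℝ) := by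
            simp only [Finset.sum_const, Finset.card_univ, Fintype.card_fin, nsmul_eq_mul]
            field_simp
        _ ≤ _ := Finset.sum_le_sum fun i _ => hrow i)
  exact ⟨j, hj⟩

/-- A continuous function is bounded above on the Frobenius unit ball. -/
lemma bddAbove_image_frobNorm_le_one {n k : ℕ} {g : Matrix (Fin n) (Fin k) ℝ → ℝ}
    (hg : Continuous g) : BddAbove (g '' {U | frobNorm U ≤ 1}) := by
  have hK : IsCompact (Set.Icc (fun _ _ => -1) (fun _ _ => 1) : Set (Fin n → Fin k → ℝ)) :=
    isCompact_Icc
  refine (hK.bddAbove_image (f := g) hg.continuousOn).mono (Set.image_mono ?_)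
  intro U hU
  have hentry (i j) : |U i j| ≤ 1 := by
    rw [Set.mem_ofPred_eq, frobNorm, Real.sqrt_le_one] at hU
    rw [← sq_le_one_iff_abs_le_one]
    calc U i j ^ 2 ≤ ∑ j, U i j ^ 2 :=
          Finset.single_le_sum (f := fun j => U i j ^ 2) (fun _ _ => sq_nonneg _)
            (Finset.mem_univ j)
      _ ≤ ∑ i, ∑ j, U i j ^ 2 :=
          Finset.single_le_sum (f := fun i => ∑ j, U i j ^ 2)
            (fun _ _ => Finset.sum_nonneg fun _ _ => sq_nonneg _) (Finset.mem_univ i)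
      _ ≤ 1 := hU
  exact ⟨fun i j => (abs_le.mp (hentry i j)).1, fun i j => (abs_le.mp (hentry i j)).2⟩

lemma frobNorm_single_one {n k : ℕ} (i : Fin n) (j : Fin k) :
    frobNorm (Matrix.single i j (1 : ℝ)) = 1 := by
  have h : ∑ a, ∑ b, (Matrix.single i j (1 : ℝ) a b) ^ 2 = 1 := by
    simp [Matrix.single_apply, ite_and]
  rw [frobNorm, h, Real.sqrt_one]

/-- The Hessian form of `(1/4)‖P - WWᵀ‖_F²` evaluated at a matrix unit. -/
lemma hessian_single {n k : ℕ} (P : Matrix (Fin n) (Fin n) ℝ) (W : Matrix (Fin n) (Fin k) ℝ)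
    (i : Fin n) (j : Fin k) :
    ((Matrix.single i j (1 : ℝ) * Wᵀ * W + W * (Matrix.single i j (1 : ℝ))ᵀ * W
      + (W * Wᵀ - P) * Matrix.single i j (1 : ℝ))ᵀ * Matrix.single i j (1 : ℝ)).trace
      = ∑ a, W a j ^ 2 + W i j ^ 2 + (∑ b, W i b ^ 2 - P i i) := by
  rw [Matrix.trace_mul_single, Matrix.mul_assoc (Matrix.single i j (1 : ℝ))]
  simp [Matrix.transpose_single, Matrix.mul_apply, Matrix.single_apply, ite_and, pow_two]

/-- For symmetric PSD `P ≥ 0` with `c = ‖P‖₂` and any row-stochastic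
`W ∈ ℝ^{n×k}`, the operator norm of the Hessian form
`D²f(W)[U, U] = ⟨U WᵀW + W UᵀW + (WWᵀ - P)U, U⟩_F` of `f(W) = (1/4)‖P - WWᵀ‖_F²`
is at least `n/k² - c`. -/
theorem stmt10 (n k : ℕ) (hn : 1 ≤ n) (hk : 1 ≤ k)
    (P : Matrix (Fin n) (Fin n) ℝ)
    (hPsymm : P.IsSymm) (hPpsd : P.PosSemidef) (hPnonneg : ∀ i j, 0 ≤ P i j)
    (c : ℝ) (hc : c = specNorm P) :
    ∀ W : Matrix (Fin n) (Fin k) ℝ,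
      (∀ i j, 0 ≤ W i j) → (∀ i, ∑ j, W i j = 1) →
      (n / k ^ 2 : ℝ) - c ≤
        sSup {r : ℝ | ∃ U : Matrix (Fin n) (Fin k) ℝ, frobNorm U ≤ 1 ∧
          r = |((U * Wᵀ * W + W * Uᵀ * W + (W * Wᵀ - P) * U)ᵀ * U).trace|} := by
  subst hc
  intro W _ hrow
  obtain ⟨j, hj⟩ := exists_div_sq_le_sum_sq_col hk W hrow
  have hP := diag_le_specNorm P ⟨0, hn⟩
  have hbdd := bddAbove_image_frobNorm_le_one
    (g := fun U : Matrix (Fin n) (Fin k) ℝ =>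
      |((U * Wᵀ * W + W * Uᵀ * W + (W * Wᵀ - P) * U)ᵀ * U).trace|) (by fun_prop)
  refine le_csSup_of_le (hbdd.mono ?_)
    ⟨Matrix.single ⟨0, hn⟩ j 1, (frobNorm_single_one _ _).le, rfl⟩ ?_
  · rintro r ⟨U, hU, rfl⟩
    exact ⟨U, hU, rfl⟩
  · rw [hessian_single]
    refine le_trans ?_ (le_abs_self _)
    have hrow_sq : 0 ≤ ∑ b, W ⟨0, hn⟩ b ^ 2 := Finset.sum_nonneg fun _ _ => sq_nonneg _
    have hentry_sq := sq_nonneg (W ⟨0, hn⟩ j)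
    linarith
end

section
/- Let P ∈ ℝ^{n×n} be a symmetric positive semidefinite matrix with nonnegative entries, c := ‖P‖₂, and D := {W ∈ ℝ^{n×k} : W ≥ 0 entrywise and W𝟙_k = 𝟙_n} with n ≥ 1 and k ≥ 2. Let f(W) = (1/4)‖P − WWᵀ‖_F² and let C̄_f be its generalized curvature constant over D. Then 2n(n/k² − c) ≤ C̄_f ≤ 2n(3n + c). -/
open Matrix

theorem sum_sum_mul_eq_trace {n : ℕ} {A : Matrix (Fin n) (Fin n) ℝ} (hA : A.IsSymm)
    (M : Matrix (Fin n) (Fin n) ℝ) : ∑ i, ∑ j, A i j * M i j = (A * M).trace := by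
  simp only [trace, diag, mul_apply]
  rw [Finset.sum_comm]
  refine Finset.sum_congr rfl fun i _ => Finset.sum_congr rfl fun j _ => ?_
  rw [hA.apply]

/-- The exact second-order remainder of `W ↦ (1/4)‖P - WWᵀ‖_F²`. -/
theorem curvature_remainder_eq {n k : ℕ} {P : Matrix (Fin n) (Fin n) ℝ} (hP : P.IsSymm)
    (X V : Matrix (Fin n) (Fin k) ℝ) {γ : ℝ} (hγ : 0 < γ) :
    2 / γ ^ 2 * |(1 / 4) * ∑ i, ∑ j, ((P - (X + γ • V) * (X + γ • V)ᵀ) i j) ^ 2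
        - (1 / 4) * ∑ i, ∑ j, ((P - X * Xᵀ) i j) ^ 2
        - (((X * Xᵀ - P) * X)ᵀ * (γ • V)).trace|
      = |(1 / 2) * ∑ i, ∑ j, ((X * Vᵀ + V * (X + γ • V)ᵀ) i j) ^ 2
        + ∑ i, ∑ j, (X * Xᵀ) i j * (V * Vᵀ) i j - ∑ i, ∑ j, P i j * (V * Vᵀ) i j| := by
  have hA : (X * Xᵀ - P).IsSymm := by
    simp [IsSymm, transpose_mul, hP.eq]
  have hAX : ∑ i, ∑ j, (X * Xᵀ - P) i j * (X * Vᵀ + V * Xᵀ) i j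
      = 2 * (((X * Xᵀ - P) * X)ᵀ * V).trace := by
    rw [sum_sum_mul_eq_trace hA]
    set A := X * Xᵀ - P
    have h1 : (A * (X * Vᵀ)).trace = ((A * X)ᵀ * V).trace := by
      rw [← Matrix.mul_assoc, trace_mul_comm, ← trace_transpose]
      simp [transpose_mul, Matrix.mul_assoc]
    have h2 : (A * (V * Xᵀ)).trace = ((A * X)ᵀ * V).trace := by
      rw [← Matrix.mul_assoc, trace_mul_comm, transpose_mul, hA.eq, Matrix.mul_assoc]
    rw [Matrix.mul_add, trace_add, h1, h2]
    ring
  have hexp : ∀ i j, (P - (X + γ • V) * (X + γ • V)ᵀ) i j ^ 2 = (P - X * Xᵀ) i j ^ 2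
      + 2 * γ * ((X * Xᵀ - P) i j * (X * Vᵀ + V * Xᵀ) i j)
      + 2 * γ ^ 2 * ((X * Xᵀ) i j * (V * Vᵀ) i j) - 2 * γ ^ 2 * (P i j * (V * Vᵀ) i j)
      + γ ^ 2 * (X * Vᵀ + V * (X + γ • V)ᵀ) i j ^ 2 := by
    intro i j
    simp only [transpose_add, transpose_smul, Matrix.mul_add, Matrix.add_mul, Matrix.mul_smul,
      Matrix.smul_mul, Matrix.sub_apply, Matrix.add_apply, Matrix.smul_apply, smul_eq_mul]
    ring
  simp only [hexp, Finset.sum_add_distrib, Finset.sum_sub_distrib, ← Finset.mul_sum, hAX]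
  rw [Matrix.mul_smul, trace_smul, smul_eq_mul,
    ← abs_of_pos (show 0 < 2 / γ ^ 2 by positivity), ← abs_mul]
  congr 1
  field_simp
  ring

theorem abs_dotProduct_mulVec_le {n : ℕ} (P : Matrix (Fin n) (Fin n) ℝ) (x : Fin n → ℝ) :
    |x ⬝ᵥ P *ᵥ x| ≤ specNorm P * (x ⬝ᵥ x) := by
  set e : EuclideanSpace ℝ (Fin n) := WithLp.toLp 2 x
  set T := LinearMap.toContinuousLinearMap (Matrix.toEuclideanLin P)
  have h1 : x ⬝ᵥ P *ᵥ x = inner ℝ (T e) e := by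
    simp [T, e, PiLp.inner_apply, dotProduct, toLpLin_apply]
  have h2 : x ⬝ᵥ x = ‖e‖ * ‖e‖ := by
    rw [← real_inner_self_eq_norm_mul_norm, PiLp.inner_apply]
    rfl
  rw [h1, h2, ← mul_assoc]
  exact (abs_real_inner_le_norm _ _).trans
    (mul_le_mul_of_nonneg_right (T.le_opNorm e) (norm_nonneg _))

theorem abs_sum_sum_mul_gram_le {n k : ℕ} (P : Matrix (Fin n) (Fin n) ℝ)
    (V : Matrix (Fin n) (Fin k) ℝ) :
    |∑ i, ∑ j, P i j * (V * Vᵀ) i j| ≤ specNorm P * ∑ i, V i ⬝ᵥ V i := by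
  have h1 : ∑ i, ∑ j, P i j * (V * Vᵀ) i j = ∑ l, V.col l ⬝ᵥ P *ᵥ V.col l := by
    simp only [dotProduct, mulVec, mul_apply, transpose_apply, col_apply, Finset.mul_sum]
    rw [Finset.sum_comm]
    simp_rw [Finset.sum_comm (s := (Finset.univ : Finset (Fin n)))
      (t := (Finset.univ : Finset (Fin k)))]
    refine Finset.sum_congr rfl fun l _ => ?_
    rw [Finset.sum_comm]
    refine Finset.sum_congr rfl fun i _ => Finset.sum_congr rfl fun j _ => ?_
    ring
  have h2 : ∑ i, V i ⬝ᵥ V i = ∑ l, V.col l ⬝ᵥ V.col l := by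
    simp only [dotProduct, col_apply]
    exact Finset.sum_comm
  rw [h1, h2, Finset.mul_sum]
  exact (Finset.abs_sum_le_sum_abs _ _).trans
    (Finset.sum_le_sum fun l _ => abs_dotProduct_mulVec_le P _)

theorem dotProduct_mem_Icc_of_mem_stdSimplex {ι : Type*} [Fintype ι] {x y : ι → ℝ}
    (hx : x ∈ stdSimplex ℝ ι) (hy : y ∈ stdSimplex ℝ ι) : x ⬝ᵥ y ∈ Set.Icc (0 : ℝ) 1 := by
  refine ⟨Finset.sum_nonneg fun i _ => mul_nonneg (hx.1 i) (hy.1 i), ?_⟩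
  rw [← hx.2]
  refine Finset.sum_le_sum fun i _ => mul_le_of_le_one_right (hx.1 i) ?_
  rw [← hy.2]
  exact Finset.single_le_sum (fun j _ => hy.1 j) (Finset.mem_univ i)

theorem dotProduct_sub_self_le_two {ι : Type*} [Fintype ι] {x y : ι → ℝ}
    (hx : x ∈ stdSimplex ℝ ι) (hy : y ∈ stdSimplex ℝ ι) : (y - x) ⬝ᵥ (y - x) ≤ 2 := by
  have hxx := (dotProduct_mem_Icc_of_mem_stdSimplex hx hx).2
  have hxy := (dotProduct_mem_Icc_of_mem_stdSimplex hx hy).1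
  have hyy := (dotProduct_mem_Icc_of_mem_stdSimplex hy hy).2
  rw [sub_dotProduct, dotProduct_sub, dotProduct_sub, dotProduct_comm y x]
  linarith

theorem sum_sum_le_card_sq_mul {n : ℕ} {g : Fin n → Fin n → ℝ} {b : ℝ} (h : ∀ i j, g i j ≤ b) :
    ∑ i, ∑ j, g i j ≤ n ^ 2 * b := by
  refine (Finset.sum_le_sum fun i _ => Finset.sum_le_sum fun j _ => h i j).trans_eq ?_
  simp
  ring

/-- Any two row-stochastic matrices satisfy `|⟨P, (S - X)(S - X)ᵀ⟩_F| ≤ 2n‖P‖₂`. -/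
theorem abs_sum_sum_mul_gram_sub_le {n k : ℕ} (P : Matrix (Fin n) (Fin n) ℝ)
    {X S : Matrix (Fin n) (Fin k) ℝ} (hX : ∀ i, X i ∈ stdSimplex ℝ (Fin k))
    (hS : ∀ i, S i ∈ stdSimplex ℝ (Fin k)) :
    |∑ i, ∑ j, P i j * ((S - X) * (S - X)ᵀ) i j| ≤ 2 * n * specNorm P := by
  have hV : ∑ i, (S - X) i ⬝ᵥ (S - X) i ≤ n * 2 := by
    refine (Finset.sum_le_sum fun i _ => dotProduct_sub_self_le_two (hX i) (hS i)).trans_eq ?_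
    simp
  refine (abs_sum_sum_mul_gram_le P _).trans ?_
  have hP : 0 ≤ specNorm P := norm_nonneg _
  exact (mul_le_mul_of_nonneg_left hV hP).trans_eq (by ring)

theorem curvature_remainder_le {n k : ℕ} (P : Matrix (Fin n) (Fin n) ℝ)
    {X S : Matrix (Fin n) (Fin k) ℝ} (hX : ∀ i, X i ∈ stdSimplex ℝ (Fin k))
    (hS : ∀ i, S i ∈ stdSimplex ℝ (Fin k)) {γ : ℝ} (hγ : γ ∈ Set.Ioc (0 : ℝ) 1) :
    |(1 / 2) * ∑ i, ∑ j, ((X * (S - X)ᵀ + (S - X) * (X + γ • (S - X))ᵀ) i j) ^ 2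
        + ∑ i, ∑ j, (X * Xᵀ) i j * ((S - X) * (S - X)ᵀ) i j
        - ∑ i, ∑ j, P i j * ((S - X) * (S - X)ᵀ) i j| ≤ 2 * n * (2 * n + specNorm P) := by
  have hY : ∀ i, (X + γ • (S - X)) i ∈ stdSimplex ℝ (Fin k) := fun i =>
    (convex_stdSimplex ℝ (Fin k)).add_smul_sub_mem (hX i) (hS i) ⟨hγ.1.le, hγ.2⟩
  set Y := X + γ • (S - X)
  have hP := abs_le.1 (abs_sum_sum_mul_gram_sub_le P hX hS)
  have hE : ∑ i, ∑ j, ((X * (S - X)ᵀ + (S - X) * Yᵀ) i j) ^ 2 ≤ n ^ 2 * 4 := by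
    refine sum_sum_le_card_sq_mul fun i j => ?_
    have h : (X * (S - X)ᵀ + (S - X) * Yᵀ) i j
        = X i ⬝ᵥ S j - X i ⬝ᵥ X j + (S i ⬝ᵥ Y j - X i ⬝ᵥ Y j) := by
      rw [← dotProduct_sub, ← sub_dotProduct]
      rfl
    have h1 := dotProduct_mem_Icc_of_mem_stdSimplex (hX i) (hS j)
    have h2 := dotProduct_mem_Icc_of_mem_stdSimplex (hX i) (hX j)
    have h3 := dotProduct_mem_Icc_of_mem_stdSimplex (hS i) (hY j)
    have h4 := dotProduct_mem_Icc_of_mem_stdSimplex (hX i) (hY j)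
    rw [h]
    refine (sq_le_sq' (b := 2) ?_ ?_).trans_eq (by norm_num)
    · linarith [h1.1, h2.2, h3.1, h4.2]
    · linarith [h1.2, h2.1, h3.2, h4.1]
  have hE0 : 0 ≤ ∑ i, ∑ j, ((X * (S - X)ᵀ + (S - X) * Yᵀ) i j) ^ 2 := by positivity
  have hG : |∑ i, ∑ j, (X * Xᵀ) i j * ((S - X) * (S - X)ᵀ) i j| ≤ n ^ 2 * 2 := by
    refine (Finset.abs_sum_le_sum_abs _ _).trans ((Finset.sum_le_sum fun i _ =>
      Finset.abs_sum_le_sum_abs _ _).trans (sum_sum_le_card_sq_mul fun i j => ?_))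
    have h : ((S - X) * (S - X)ᵀ) i j
        = S i ⬝ᵥ S j - S i ⬝ᵥ X j - (X i ⬝ᵥ S j - X i ⬝ᵥ X j) := by
      rw [← dotProduct_sub, ← dotProduct_sub, ← sub_dotProduct]
      rfl
    have h1 := dotProduct_mem_Icc_of_mem_stdSimplex (hX i) (hS j)
    have h2 := dotProduct_mem_Icc_of_mem_stdSimplex (hX i) (hX j)
    have h3 := dotProduct_mem_Icc_of_mem_stdSimplex (hS i) (hS j)
    have h4 := dotProduct_mem_Icc_of_mem_stdSimplex (hS i) (hX j)
    have hXX : |(X * Xᵀ) i j| ≤ 1 := abs_le.2 ⟨by linarith [show 0 ≤ (X * Xᵀ) i j from h2.1], h2.2⟩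
    have hVV : |((S - X) * (S - X)ᵀ) i j| ≤ 2 := by
      rw [h, abs_le]
      constructor <;> linarith [h1.1, h1.2, h2.1, h2.2, h3.1, h3.2, h4.1, h4.2]
    rw [abs_mul]
    exact (mul_le_mul hXX hVV (abs_nonneg _) zero_le_one).trans_eq (one_mul 2)
  have hG := abs_le.1 hG
  rw [abs_le]
  constructor <;> nlinarith [hP.1, hP.2, hG.1, hG.2, sq_nonneg (n : ℝ)]

/-- For symmetric PSD `P ≥ 0` with `c = ‖P‖₂`, the generalized curvature
constant `C̄_f` of `f(W) = (1/4)‖P - WWᵀ‖_F²` over the set of `n × k` row-stochastic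
matrices (`n ≥ 1`, `k ≥ 2`) satisfies `2n(n/k² - c) ≤ C̄_f ≤ 2n(3n + c)`. Here
`C̄_f = sup (2/γ²)|f(Y) - f(X) - ⟨∇f(X), Y - X⟩_F|` over row-stochastic `X, S`,
`γ ∈ (0,1]`, `Y = X + γ(S - X)`, with `∇f(X) = (XXᵀ - P)X`. -/
theorem stmt11 (n k : ℕ) (hn : 1 ≤ n) (hk : 2 ≤ k)
    (P : Matrix (Fin n) (Fin n) ℝ)
    (hPsymm : P.IsSymm) (hPpsd : P.PosSemidef) (hPnonneg : ∀ i j, 0 ≤ P i j)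
    (c : ℝ) (hc : c = specNorm P)
    (f : Matrix (Fin n) (Fin k) ℝ → ℝ)
    (hf : f = fun W => (1 / 4) * ∑ i, ∑ j, ((P - W * Wᵀ) i j) ^ 2)
    (curv : ℝ)
    (hcurv : curv = sSup {r : ℝ | ∃ X S : Matrix (Fin n) (Fin k) ℝ, ∃ γ : ℝ,
      (∀ i j, 0 ≤ X i j) ∧ (∀ i, ∑ j, X i j = 1) ∧
      (∀ i j, 0 ≤ S i j) ∧ (∀ i, ∑ j, S i j = 1) ∧ γ ∈ Set.Ioc (0 : ℝ) 1 ∧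
      r = 2 / γ ^ 2 * |f (X + γ • (S - X)) - f X -
            ((((X * Xᵀ - P) * X)ᵀ) * (γ • (S - X))).trace|}) :
    2 * n * (n / k ^ 2 - c) ≤ curv ∧ curv ≤ 2 * n * (3 * n + c) := by
  subst hc hf hcurv
  set R := {r : ℝ | ∃ X S : Matrix (Fin n) (Fin k) ℝ, ∃ γ : ℝ,
      (∀ i j, 0 ≤ X i j) ∧ (∀ i, ∑ j, X i j = 1) ∧
      (∀ i j, 0 ≤ S i j) ∧ (∀ i, ∑ j, S i j = 1) ∧ γ ∈ Set.Ioc (0 : ℝ) 1 ∧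
      r = 2 / γ ^ 2 * |(fun W : Matrix (Fin n) (Fin k) ℝ =>
              (1 / 4) * ∑ i, ∑ j, ((P - W * Wᵀ) i j) ^ 2) (X + γ • (S - X))
            - (fun W : Matrix (Fin n) (Fin k) ℝ =>
              (1 / 4) * ∑ i, ∑ j, ((P - W * Wᵀ) i j) ^ 2) X -
            ((((X * Xᵀ - P) * X)ᵀ) * (γ • (S - X))).trace|}
  have hupper : ∀ r ∈ R, r ≤ 2 * n * (3 * n + specNorm P) := by
    rintro r ⟨X, S, γ, hX0, hX1, hS0, hS1, hγ, rfl⟩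
    refine (curvature_remainder_eq hPsymm X (S - X) hγ.1).trans_le ?_
    refine (curvature_remainder_le P (fun i => ⟨hX0 i, hX1 i⟩)
      (fun i => ⟨hS0 i, hS1 i⟩) hγ).trans ?_
    nlinarith [sq_nonneg (n : ℝ)]
  let a : Fin k := ⟨0, by omega⟩
  let b : Fin k := ⟨1, by omega⟩
  have hab : a ≠ b := by simp [a, b]
  let X : Matrix (Fin n) (Fin k) ℝ := fun _ => Pi.single a 1
  let S : Matrix (Fin n) (Fin k) ℝ := fun _ => Pi.single b 1
  have hX : ∀ i, X i ∈ stdSimplex ℝ (Fin k) := fun _ => single_mem_stdSimplex ℝ a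
  have hS : ∀ i, S i ∈ stdSimplex ℝ (Fin k) := fun _ => single_mem_stdSimplex ℝ b
  have hmem : _ ∈ R := ⟨X, S, 1, fun i => (hX i).1, fun i => (hX i).2, fun i => (hS i).1,
    fun i => (hS i).2, ⟨one_pos, le_rfl⟩, rfl⟩
  refine ⟨?_, csSup_le ⟨_, hmem⟩ hupper⟩
  refine le_trans ?_ (le_csSup ⟨_, hupper⟩ hmem)
  refine le_trans ?_ (curvature_remainder_eq hPsymm X (S - X) one_pos).ge
  refine le_trans ?_ (le_abs_self _)
  have hP := (abs_le.1 (abs_sum_sum_mul_gram_sub_le P hX hS)).2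
  have hG : ∑ i, ∑ j, (X * Xᵀ) i j * ((S - X) * (S - X)ᵀ) i j = n ^ 2 * 2 := by
    have h : ∀ i j, (X * Xᵀ) i j * ((S - X) * (S - X)ᵀ) i j = 2 := by
      intro i j
      have h1 : (X * Xᵀ) i j = 1 := by
        change (Pi.single a 1 : Fin k → ℝ) ⬝ᵥ Pi.single a 1 = 1
        simp
      have h2 : ((S - X) * (S - X)ᵀ) i j = 2 := by
        change (Pi.single b 1 - Pi.single a 1 : Fin k → ℝ) ⬝ᵥ (Pi.single b 1 - Pi.single a 1) = 2
        simp [hab, hab.symm]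
        norm_num
      rw [h1, h2, one_mul]
    simp only [h]
    simp
    ring
  have hE : 0 ≤ ∑ i, ∑ j, ((X * (S - X)ᵀ + (S - X) * (X + (1 : ℝ) • (S - X))ᵀ) i j) ^ 2 := by
    positivity
  have hk1 : (1 : ℝ) ≤ (k : ℝ) ^ 2 := one_le_pow₀ (by exact_mod_cast (by omega : 1 ≤ k))
  have hnk : (n : ℝ) / k ^ 2 ≤ n := div_le_self n.cast_nonneg hk1
  have hnn : 2 * (n : ℝ) * (n / k ^ 2) ≤ 2 * n * n := by gcongr
  rw [hG]
  nlinarith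
end

section
/- Let D := {(x₁, x₂) ∈ ℝ² : x₂ ≤ 3, 3x₁ + x₂ ≥ 0, −3x₁ + x₂ ≥ 0} and f(x₁, x₂) := max{5x₁ + x₂, −5x₁ + x₂}. Let (x⁽ᵗ⁾) be any sequence in D with x⁽ᵗ⁺¹⁾ = x⁽ᵗ⁾ + γ_t (s⁽ᵗ⁾ − x⁽ᵗ⁾), where each step size γ_t ∈ (0, 1] and each s⁽ᵗ⁾ ∈ {(−1, 3), (1, 3)}. Then the second coordinate satisfies x₂⁽ᵀ⁾ = 3 − (3 − x₂⁽⁰⁾)·∏_{t=0}^{T−1}(1 − γ_t) for every T ≥ 0, and hence f(x⁽ᵀ⁾) ≥ 3 − (3 − x₂⁽⁰⁾)·∏_{t=0}^{T−1}(1 − γ_t). In particular, if ∏_{t=0}^{T−1}(1 − γ_t) → 0 as T → ∞, then liminf_{T→∞} f(x⁽ᵀ⁾) ≥ 3 > 0 = min_{x ∈ D} f(x), so the sequence fails to converge to the optimum. -/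
open Filter

/-- Averaging towards a constant target `c` contracts the distance to `c` by `∏ (1 - γ t)`. -/
theorem eq_sub_mul_prod_of_succ_eq_add {R : Type*} [CommRing R] {c : R} {a γ : ℕ → R}
    (h : ∀ t, a (t + 1) = a t + γ t * (c - a t)) (T : ℕ) :
    a T = c - (c - a 0) * ∏ t ∈ Finset.range T, (1 - γ t) := by
  induction T with
  | zero => simp
  | succ n ih => rw [h, Finset.prod_range_succ, ih]; ring

/-- Failure of Frank-Wolfe on `f(x₁,x₂) = max {5x₁ + x₂, -5x₁ + x₂}` over the
triangle with vertices `(-1,3)`, `(1,3)`, `(0,0)`. For any sequence in `D` with updates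
`x⁽ᵗ⁺¹⁾ = x⁽ᵗ⁾ + γ_t(s⁽ᵗ⁾ - x⁽ᵗ⁾)`, `γ_t ∈ (0,1]`, `s⁽ᵗ⁾ ∈ {(-1,3),(1,3)}`, the second
coordinate satisfies `x₂⁽ᵀ⁾ = 3 - (3 - x₂⁽⁰⁾)∏(1-γ_t)`, hence `f(x⁽ᵀ⁾) ≥ 3 - (3 - x₂⁽⁰⁾)∏(1-γ_t)`;
if `∏(1-γ_t) → 0` then `liminf f(x⁽ᵀ⁾) ≥ 3 > 0 = min_D f`, so the iterates fail to
converge to the optimum. -/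
theorem stmt15 (D : Set (ℝ × ℝ))
    (hD : D = {p : ℝ × ℝ | p.2 ≤ 3 ∧ 0 ≤ 3 * p.1 + p.2 ∧ 0 ≤ -3 * p.1 + p.2})
    (f : ℝ × ℝ → ℝ)
    (hf : f = fun p => max (5 * p.1 + p.2) (-5 * p.1 + p.2))
    (x s : ℕ → ℝ × ℝ) (γ : ℕ → ℝ)
    (hxD : ∀ t, x t ∈ D)
    (hγ : ∀ t, γ t ∈ Set.Ioc (0 : ℝ) 1)
    (hs : ∀ t, s t = ((-1, 3) : ℝ × ℝ) ∨ s t = ((1, 3) : ℝ × ℝ))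
    (hupd : ∀ t, x (t + 1) = x t + γ t • (s t - x t)) :
    (∀ T : ℕ, (x T).2 = 3 - (3 - (x 0).2) * ∏ t ∈ Finset.range T, (1 - γ t)) ∧
    (∀ T : ℕ, 3 - (3 - (x 0).2) * ∏ t ∈ Finset.range T, (1 - γ t) ≤ f (x T)) ∧
    (Tendsto (fun T => ∏ t ∈ Finset.range T, (1 - γ t)) atTop (nhds 0) →
      (3 : ℝ) ≤ liminf (fun T => f (x T)) atTop ∧
      sInf (f '' D) = 0 ∧ (0 : ℝ) < 3) := by
  subst hD hf
  have hsnd : ∀ T : ℕ, (x T).2 = 3 - (3 - (x 0).2) * ∏ t ∈ Finset.range T, (1 - γ t) := by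
    refine eq_sub_mul_prod_of_succ_eq_add (a := fun t => (x t).2) fun t => ?_
    have h3 : (s t).2 = 3 := by rcases hs t with h | h <;> rw [h]
    simp [hupd, h3]
  have hle_max : ∀ p : ℝ × ℝ, p.2 ≤ max (5 * p.1 + p.2) (-5 * p.1 + p.2) := fun p => by
    rcases le_total 0 p.1 with h | h
    · exact le_max_of_le_left (by linarith)
    · exact le_max_of_le_right (by linarith)
  refine ⟨hsnd, fun T => hsnd T ▸ hle_max (x T), fun hprod => ⟨?_, ?_, by norm_num⟩⟩
  · have hlim : Tendsto (fun T => (x T).2) atTop (nhds 3) := by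
      rw [funext hsnd]
      simpa using (hprod.const_mul (3 - (x 0).2)).const_sub 3
    rw [← hlim.liminf_eq]
    refine liminf_le_liminf (.of_forall fun T => hle_max (x T)) hlim.isBoundedUnder_ge ?_
    refine (isBoundedUnder_of ⟨8, fun T => ?_⟩ :
      IsBoundedUnder (· ≤ ·) atTop _).isCoboundedUnder_ge
    obtain ⟨h1, h2, h3⟩ := hxD T
    exact max_le (by linarith) (by linarith)
  · refine IsLeast.csInf_eq ⟨⟨(0, 0), by norm_num, by norm_num⟩, ?_⟩
    rintro _ ⟨p, ⟨-, h2, h3⟩, rfl⟩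
    exact (by linarith : (0 : ℝ) ≤ p.2).trans (hle_max p)
end

section
/- Let D := {(x₁, x₂) ∈ ℝ² : x₂ ≤ 3, 3x₁ + x₂ ≥ 0, −3x₁ + x₂ ≥ 0} and f(x₁, x₂) := max{5x₁ + x₂, −5x₁ + x₂}. Then the curvature constant of f over D is infinite: for every M > 0 there exist x, s ∈ D and γ ∈ (0, 1] such that f is differentiable at x and, with y := x + γ(s − x), (2/γ²)(f(y) − f(x) − ⟨∇f(x), y − x⟩) > M. (For instance, x = (−ε, 3), s = (1 − ε, 3), with ε > 0 small and γ > ε small.) -/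
/-- On the open left half-plane, `max {5x₁ + x₂, -5x₁ + x₂}` has derivative `(-5, 1)`. -/
theorem hasFDerivAt_max_of_fst_neg {x : ℝ × ℝ} (hx : x.1 < 0) :
    HasFDerivAt (fun p : ℝ × ℝ => max (5 * p.1 + p.2) (-5 * p.1 + p.2))
      ((-5 : ℝ) • ContinuousLinearMap.fst ℝ ℝ ℝ + ContinuousLinearMap.snd ℝ ℝ ℝ) x := by
  refine (ContinuousLinearMap.hasFDerivAt
    ((-5 : ℝ) • ContinuousLinearMap.fst ℝ ℝ ℝ + ContinuousLinearMap.snd ℝ ℝ ℝ)).congr_of_eventuallyEq ?_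
  filter_upwards [continuous_fst.continuousAt.eventually_lt continuousAt_const hx] with p hp
  simpa using by linarith

/-- The curvature constant of `f(x₁,x₂) = max {5x₁ + x₂, -5x₁ + x₂}` over the
triangle `D` with vertices `(-1,3)`, `(1,3)`, `(0,0)` is infinite: for every `M > 0` there
are `x, s ∈ D` and `γ ∈ (0,1]` with `f` differentiable at `x` such that, with
`y = x + γ(s - x)`, `(2/γ²)(f(y) - f(x) - ⟨∇f(x), y - x⟩) > M`. -/
theorem stmt16 (D : Set (ℝ × ℝ))
    (hD : D = {p : ℝ × ℝ | p.2 ≤ 3 ∧ 0 ≤ 3 * p.1 + p.2 ∧ 0 ≤ -3 * p.1 + p.2})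
    (f : ℝ × ℝ → ℝ)
    (hf : f = fun p => max (5 * p.1 + p.2) (-5 * p.1 + p.2)) :
    ∀ M : ℝ, 0 < M →
      ∃ x ∈ D, ∃ s ∈ D, ∃ γ ∈ Set.Ioc (0 : ℝ) 1, ∃ φ : ℝ × ℝ →L[ℝ] ℝ,
        HasFDerivAt f φ x ∧
        M < 2 / γ ^ 2 * (f (x + γ • (s - x)) - f x - φ (γ • (s - x))) := by
  subst hD hf
  intro M hM
  obtain ⟨ε, hε, hε_half, hMε⟩ : ∃ ε : ℝ, 0 < ε ∧ 2 * ε ≤ 1 ∧ M < 5 / ε := by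
    refine ⟨1 / (M + 2), by positivity, ?_, ?_⟩
    · rw [mul_one_div, div_le_one (by positivity)]
      linarith
    · rw [div_div_eq_mul_div, div_one]
      linarith
  refine ⟨(-ε, 3), ⟨by norm_num, by dsimp only; linarith, by dsimp only; linarith⟩,
    (1 - ε, 3), ⟨by norm_num, by dsimp only; linarith, by dsimp only; linarith⟩,
    2 * ε, ⟨by positivity, hε_half⟩, _, hasFDerivAt_max_of_fst_neg (neg_lt_zero.mpr hε), ?_⟩
  have hy : ((-ε, 3) : ℝ × ℝ) + (2 * ε) • ((1 - ε, 3) - (-ε, 3)) = (ε, 3) := by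
    ext <;> simp
    ring
  have hf_y : max (5 * ε + 3) (-5 * ε + 3) = 5 * ε + 3 := max_eq_left (by linarith)
  have hf_x : max (5 * -ε + 3) (-5 * -ε + 3) = 5 * ε + 3 := by
    rw [max_eq_right (by linarith)]
    ring
  rw [hy]
  dsimp only
  rw [hf_y, hf_x]
  convert hMε using 1
  simp
  field_simp
end

section
/- Let D := {(x₁, x₂) ∈ ℝ² : x₂ ≤ 3, 3x₁ + x₂ ≥ 0, −3x₁ + x₂ ≥ 0} and f(x₁, x₂) := max{x₁/2 + x₂, −x₁/2 + x₂} = |x₁|/2 + x₂. Then for every x ∈ D and every subgradient g ∈ ℝ² of f at x (i.e., every g with f(y) ≥ f(x) + ⟨g, y − x⟩ for all y ∈ ℝ²), the point (0, 0) is the unique minimizer of s ↦ ⟨g, s⟩ over D; that is, the linear minimization oracle of the Frank-Wolfe algorithm returns (0, 0) at every feasible point, regardless of the choice of subgradient. -/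
/-- A subgradient of `(x₁,x₂) ↦ max {x₁/2 + x₂, -x₁/2 + x₂}` has second coordinate `1` and first
coordinate in `[-1/2, 1/2]`. -/
theorem subgradient_max_bounds {x g : ℝ × ℝ}
    (hg : ∀ y : ℝ × ℝ, max (x.1 / 2 + x.2) (-x.1 / 2 + x.2) +
      (g.1 * (y.1 - x.1) + g.2 * (y.2 - x.2)) ≤ max (y.1 / 2 + y.2) (-y.1 / 2 + y.2)) :
    g.2 = 1 ∧ -(1 / 2) ≤ g.1 ∧ g.1 ≤ 1 / 2 := by
  have hl := le_max_left (x.1 / 2 + x.2) (-x.1 / 2 + x.2)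
  have hr := le_max_right (x.1 / 2 + x.2) (-x.1 / 2 + x.2)
  have key (a b : ℝ) : g.1 * a + g.2 * b ≤ |a| / 2 + b := by
    have h := hg (x.1 + a, x.2 + b)
    simp only [add_sub_cancel_left] at h
    have ha := le_abs_self a
    have ha' := neg_abs_le a
    rcases le_max_iff.mp h with h | h <;> linarith
  have h₁ := key 0 1
  have h₂ := key 0 (-1)
  have h₃ := key 1 0
  have h₄ := key (-1) 0
  norm_num at h₁ h₂ h₃ h₄
  exact ⟨by linarith, by linarith, by linarith⟩

/-- For `f(x₁,x₂) = max {x₁/2 + x₂, -x₁/2 + x₂}` over the triangle `D` with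
vertices `(-1,3)`, `(1,3)`, `(0,0)`: at every `x ∈ D` and for every subgradient `g` of `f`
at `x`, the point `(0,0)` is the unique minimizer of `s ↦ ⟨g, s⟩` over `D`; i.e., the LMO
returns `(0,0)` everywhere, regardless of the chosen subgradient. -/
theorem stmt17 (D : Set (ℝ × ℝ))
    (hD : D = {p : ℝ × ℝ | p.2 ≤ 3 ∧ 0 ≤ 3 * p.1 + p.2 ∧ 0 ≤ -3 * p.1 + p.2})
    (f : ℝ × ℝ → ℝ)
    (hf : f = fun p => max (p.1 / 2 + p.2) (-p.1 / 2 + p.2)) :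
    ∀ x ∈ D, ∀ g : ℝ × ℝ,
      (∀ y : ℝ × ℝ, f x + (g.1 * (y.1 - x.1) + g.2 * (y.2 - x.2)) ≤ f y) →
      ((0, 0) : ℝ × ℝ) ∈ D ∧
      (∀ s ∈ D, g.1 * 0 + g.2 * 0 ≤ g.1 * s.1 + g.2 * s.2) ∧
      (∀ s ∈ D, s ≠ ((0, 0) : ℝ × ℝ) → g.1 * 0 + g.2 * 0 < g.1 * s.1 + g.2 * s.2) := by
  subst hD hf
  intro x _ g hg
  obtain ⟨hg₂, hlo, hhi⟩ := subgradient_max_bounds hg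
  have hpos : ∀ s ∈ {p : ℝ × ℝ | p.2 ≤ 3 ∧ 0 ≤ 3 * p.1 + p.2 ∧ 0 ≤ -3 * p.1 + p.2},
      s ≠ ((0, 0) : ℝ × ℝ) → g.1 * 0 + g.2 * 0 < g.1 * s.1 + g.2 * s.2 := by
    rintro ⟨a, b⟩ ⟨-, h₁, h₂⟩ hne
    dsimp only at h₁ h₂ ⊢
    have hb : 0 < b := by
      by_contra! hb
      exact hne (Prod.ext (by dsimp only; linarith) (by dsimp only; linarith))
    rw [hg₂]
    nlinarith [mul_nonneg (sub_nonneg.mpr hhi) h₂, mul_nonneg (sub_nonneg.mpr hlo) h₁]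
  refine ⟨by norm_num, fun s hs => ?_, hpos⟩
  rcases eq_or_ne s (0, 0) with rfl | hne
  · exact le_rfl
  · exact (hpos s hs hne).le
end

section
/- Let D := {(x₁, x₂) ∈ ℝ² : x₂ ≤ 3, 3x₁ + x₂ ≥ 0, −3x₁ + x₂ ≥ 0} and f(x₁, x₂) := max{x₁/2 + x₂, −x₁/2 + x₂} = |x₁|/2 + x₂. Then the curvature constant of f over D is infinite: for every M > 0 there exist x, s ∈ D and γ ∈ (0, 1] such that f is differentiable at x and, with y := x + γ(s − x), (2/γ²)(f(y) − f(x) − ⟨∇f(x), y − x⟩) > M. -/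
/-- The curvature constant of `f(x₁,x₂) = max {x₁/2 + x₂, -x₁/2 + x₂}` over
the triangle `D` with vertices `(-1,3)`, `(1,3)`, `(0,0)` is infinite: for every `M > 0`
there are `x, s ∈ D` and `γ ∈ (0,1]` with `f` differentiable at `x` such that, with
`y = x + γ(s - x)`, `(2/γ²)(f(y) - f(x) - ⟨∇f(x), y - x⟩) > M`. -/
theorem stmt19 (D : Set (ℝ × ℝ))
    (hD : D = {p : ℝ × ℝ | p.2 ≤ 3 ∧ 0 ≤ 3 * p.1 + p.2 ∧ 0 ≤ -3 * p.1 + p.2})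
    (f : ℝ × ℝ → ℝ)
    (hf : f = fun p => max (p.1 / 2 + p.2) (-p.1 / 2 + p.2)) :
    ∀ M : ℝ, 0 < M →
      ∃ x ∈ D, ∃ s ∈ D, ∃ γ ∈ Set.Ioc (0 : ℝ) 1, ∃ φ : ℝ × ℝ →L[ℝ] ℝ,
        HasFDerivAt f φ x ∧
        M < 2 / γ ^ 2 * (f (x + γ • (s - x)) - f x - φ (γ • (s - x))) := by
  intro M hM
  subst hD hf
  obtain ⟨ε, hε, hε₁, hεM⟩ : ∃ ε : ℝ, 0 < ε ∧ 2 * ε ≤ 1 ∧ 2 * ε * M < 1 := by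
    refine ⟨1 / (2 * (M + 1)), by positivity, ?_, ?_⟩
    · rw [mul_one_div, div_le_one (by positivity)]
      linarith
    · rw [mul_one_div, div_mul_eq_mul_div, div_lt_one (by positivity)]
      linarith
  refine ⟨(ε, 3), ⟨le_rfl, ?_, ?_⟩, (-1, 3), ⟨le_rfl, ?_, ?_⟩, 2 * ε, ⟨by positivity, hε₁⟩,
    (1 / 2 : ℝ) • ContinuousLinearMap.fst ℝ ℝ ℝ + ContinuousLinearMap.snd ℝ ℝ ℝ, ?_, ?_⟩
  · dsimp only
    linarith
  · dsimp only
    linarith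
  · norm_num
  · norm_num
  · refine ((1 / 2 : ℝ) • ContinuousLinearMap.fst ℝ ℝ ℝ +
      ContinuousLinearMap.snd ℝ ℝ ℝ).hasFDerivAt.congr_of_eventuallyEq ?_
    filter_upwards [continuous_fst.continuousAt.eventually (lt_mem_nhds hε)] with p hp
    rw [max_eq_left (by linarith)]
    simp
    ring
  · have gap : max ((ε + 2 * ε * (-1 - ε)) / 2 + 3) (-(ε + 2 * ε * (-1 - ε)) / 2 + 3)
        - max (ε / 2 + 3) (-ε / 2 + 3) - (1 / 2) * (2 * ε * (-1 - ε)) = ε * (1 + 2 * ε) := by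
      rw [max_eq_right (by nlinarith), max_eq_left (by linarith)]
      ring
    have bound : M < 2 / (2 * ε) ^ 2 * (ε * (1 + 2 * ε)) := by
      rw [div_mul_eq_mul_div, lt_div_iff₀ (by positivity)]
      nlinarith
    rw [← gap] at bound
    simpa using bound
end
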